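/- Guerra interpolation lower bound: if P0 has finite support S ⊆ [−K,K], then for every λ > 0, liminf_{n→∞} F_n(λ) ≥ sup_{q ≥ 0} 𝓕(λ,q). -/

import Mathlib

/-!
Guerra interpolation lower bound: if `P0` has finite support `S ⊆ [−K, K]`, then for
every `λ > 0`, `liminf_{n→∞} F_n(λ) ≥ sup_{q ≥ 0} 𝓕(λ, q)`.
-/

open MeasureTheory ProbabilityTheory Filter Finset Real

noncomputable section

/-- The standard Gaussian measure on `ℝ`. -/
def stdGauss : Measure ℝ := gaussianReal 0 1

/-- The set of pairs `(i, j)` with `i < j`. -/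
def pairs (n : ℕ) : Finset (Fin n × Fin n) :=
  Finset.univ.filter fun p => p.1 < p.2

/-- The Hamiltonian of the spiked Wigner model. -/
def hamiltonian (n : ℕ) (lam : ℝ) (X : Fin n → ℝ) (Z : Fin n × Fin n → ℝ)
    (x : Fin n → ℝ) : ℝ :=
  ∑ p ∈ pairs n,
    (Real.sqrt (lam / n) * x p.1 * x p.2 * Z p
      + lam / n * X p.1 * X p.2 * x p.1 * x p.2
      - lam / (2 * n) * (x p.1) ^ 2 * (x p.2) ^ 2)

/-- The free energy `F_n(λ)`. -/
def freeEnergy (P0 : Measure ℝ) (n : ℕ) (lam : ℝ) : ℝ :=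
  (1 / n) * ∫ X, (∫ Z,
      Real.log (∫ x, Real.exp (hamiltonian n lam X Z x)
        ∂(Measure.pi fun _ : Fin n => P0))
    ∂(Measure.pi fun _ : Fin n × Fin n => stdGauss))
    ∂(Measure.pi fun _ : Fin n => P0)

/-- The scalar free energy `ψ_{P0}`. -/
def scalarFE (P0 : Measure ℝ) (γ : ℝ) : ℝ :=
  ∫ x0, (∫ z,
      Real.log (∫ x,
        Real.exp (Real.sqrt γ * z * x + γ * x * x0 - γ / 2 * x ^ 2) ∂P0)
    ∂stdGauss) ∂P0

/-- The Replica-Symmetric potential `𝓕(λ, q) = ψ_{P0}(λ q) − (λ/4) q²`. -/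
def RSpot (P0 : Measure ℝ) (lam q : ℝ) : ℝ :=
  scalarFE P0 (lam * q) - lam / 4 * q ^ 2

/-- `sup_{q ≥ 0} 𝓕(λ, q)`. -/
def RSsup (P0 : Measure ℝ) (lam : ℝ) : ℝ :=
  sSup (RSpot P0 lam '' Set.Ici 0)

instance : IsProbabilityMeasure stdGauss := by
  unfold stdGauss; infer_instance

/-- The product of standard Gaussian measures. -/
abbrev stdGaussPi (A : Type*) [Fintype A] : Measure (A → ℝ) := Measure.pi fun _ : A => stdGauss

section Growth

variable {A Θ : Type*} [Fintype A]

/-- A family of functions on `A → ℝ` grows at most exponentially, uniformly in the parameter. -/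
def ExpGrowth (f : Θ → (A → ℝ) → ℝ) : Prop :=
  ∃ C k : ℝ, 0 ≤ C ∧ 0 ≤ k ∧ ∀ θ y, |f θ y| ≤ C * exp (k * ∑ a, |y a|)

lemma ExpGrowth.of_bounded {f : Θ → (A → ℝ) → ℝ} {C : ℝ} (h : ∀ θ y, |f θ y| ≤ C) :
    ExpGrowth f := by
  refine ⟨|C|, 0, abs_nonneg _, le_rfl, fun θ y => ?_⟩
  simpa using (h θ y).trans (le_abs_self C)

lemma ExpGrowth.mono {f g : Θ → (A → ℝ) → ℝ} (hg : ExpGrowth g)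
    (h : ∀ θ y, |f θ y| ≤ |g θ y|) : ExpGrowth f := by
  obtain ⟨C, k, hC, hk, hb⟩ := hg
  exact ⟨C, k, hC, hk, fun θ y => (h θ y).trans (hb θ y)⟩

lemma ExpGrowth.mul {f g : Θ → (A → ℝ) → ℝ} (hf : ExpGrowth f) (hg : ExpGrowth g) :
    ExpGrowth fun θ y => f θ y * g θ y := by
  obtain ⟨C, k, hC, hk, hb⟩ := hf
  obtain ⟨C', k', hC', hk', hb'⟩ := hg
  refine ⟨C * C', k + k', by positivity, by positivity, fun θ y => ?_⟩
  rw [abs_mul, add_mul, exp_add]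
  calc |f θ y| * |g θ y| ≤ (C * exp (k * ∑ a, |y a|)) * (C' * exp (k' * ∑ a, |y a|)) := by
        gcongr
        exacts [hb θ y, hb' θ y]
    _ = _ := by ring

lemma ExpGrowth.add {f g : Θ → (A → ℝ) → ℝ} (hf : ExpGrowth f) (hg : ExpGrowth g) :
    ExpGrowth fun θ y => f θ y + g θ y := by
  obtain ⟨C, k, hC, hk, hb⟩ := hf
  obtain ⟨C', k', hC', hk', hb'⟩ := hg
  refine ⟨C + C', k + k', by positivity, by positivity, fun θ y => ?_⟩
  have hs : 0 ≤ ∑ a, |y a| := Finset.sum_nonneg fun a _ => abs_nonneg _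
  calc |f θ y + g θ y| ≤ |f θ y| + |g θ y| := abs_add_le _ _
    _ ≤ C * exp (k * ∑ a, |y a|) + C' * exp (k' * ∑ a, |y a|) := add_le_add (hb θ y) (hb' θ y)
    _ ≤ C * exp ((k + k') * ∑ a, |y a|) + C' * exp ((k + k') * ∑ a, |y a|) := by
        gcongr <;> linarith
    _ = _ := by ring

lemma ExpGrowth.sum {ι : Type*} (T : Finset ι) {f : ι → Θ → (A → ℝ) → ℝ}
    (hf : ∀ i ∈ T, ExpGrowth (f i)) : ExpGrowth fun θ y => ∑ i ∈ T, f i θ y := by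
  classical
  induction T using Finset.induction_on with
  | empty => exact ExpGrowth.of_bounded (C := 0) (by simp)
  | insert i T hi ih =>
    simp only [Finset.sum_insert hi]
    exact (hf i (by simp)).add (ih fun j hj => hf j (by simp [hj]))

lemma ExpGrowth.exp_of_le {g : Θ → (A → ℝ) → ℝ} {D k : ℝ}
    (h : ∀ θ y, g θ y ≤ D + k * ∑ a, |y a|) : ExpGrowth fun θ y => exp (g θ y) := by
  refine ⟨exp D, |k|, by positivity, by positivity, fun θ y => ?_⟩
  have hs : 0 ≤ ∑ a, |y a| := Finset.sum_nonneg fun a _ => abs_nonneg _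
  rw [abs_exp, ← exp_add]
  refine exp_le_exp.2 ((h θ y).trans ?_)
  gcongr
  exact le_abs_self k

lemma ExpGrowth.of_abs_le {g : Θ → (A → ℝ) → ℝ} {D k : ℝ}
    (h : ∀ θ y, |g θ y| ≤ D + k * ∑ a, |y a|) : ExpGrowth g := by
  refine (ExpGrowth.exp_of_le (g := fun θ y => |g θ y|) h).mono fun θ y => ?_
  rw [abs_exp]
  linarith [add_one_le_exp (|g θ y|)]

lemma ExpGrowth.coord (a : A) : ExpGrowth fun (_ : Θ) (y : A → ℝ) => y a := by
  refine ExpGrowth.of_abs_le (D := 0) (k := 1) fun _ y => ?_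
  rw [zero_add, one_mul]
  exact Finset.single_le_sum (f := fun a => |y a|) (fun a _ => abs_nonneg _) (Finset.mem_univ a)

lemma integrable_exp_mul_abs_stdGauss (k : ℝ) :
    Integrable (fun t => exp (k * |t|)) stdGauss := by
  exact integrable_exp_mul_abs (X := fun t => t) (integrable_exp_mul_gaussianReal k)
    (integrable_exp_mul_gaussianReal (-k))

lemma integrable_exp_mul_sum_abs (k : ℝ) :
    Integrable (fun y : A → ℝ => exp (k * ∑ a, |y a|)) (stdGaussPi A) := by
  simp_rw [Finset.mul_sum, exp_sum]
  exact Integrable.fintype_prod (f := fun (_ : A) (t : ℝ) => exp (k * |t|))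
    fun _ => integrable_exp_mul_abs_stdGauss k

lemma ExpGrowth.integrable {f : Θ → (A → ℝ) → ℝ} (hf : ExpGrowth f) (θ : Θ)
    (hc : Continuous (f θ)) : Integrable (f θ) (stdGaussPi A) := by
  obtain ⟨C, k, hC, hk, hb⟩ := hf
  refine ((integrable_exp_mul_sum_abs k).const_mul C).mono' hc.aestronglyMeasurable ?_
  exact Eventually.of_forall fun y => hb θ y

end Growth

section Gaussian

variable {A : Type*} [Fintype A]

lemma integral_stdGauss (f : ℝ → ℝ) :
    ∫ t, f t ∂stdGauss = ∫ t, gaussianPDFReal 0 1 t * f t := by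
  simpa [stdGauss] using integral_gaussianReal_eq_integral_smul (μ := 0) (v := 1) (f := f) (by simp)

lemma integrable_stdGauss_iff (f : ℝ → ℝ) :
    Integrable f stdGauss ↔ Integrable fun t => gaussianPDFReal 0 1 t * f t := by
  rw [stdGauss, gaussianReal_of_var_ne_zero _ one_ne_zero,
    integrable_withDensity_iff_integrable_smul' (measurable_gaussianPDF 0 1)
      (Eventually.of_forall fun _ => gaussianPDF_lt_top)]
  simp [toReal_gaussianPDF]

/-- Gaussian integration by parts on the line. -/
lemma integral_mul_stdGauss {h h' : ℝ → ℝ} (hd : ∀ t, HasDerivAt h (h' t) t)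
    (hi : Integrable h stdGauss) (hi' : Integrable h' stdGauss)
    (hti : Integrable (fun t => t * h t) stdGauss) :
    ∫ t, t * h t ∂stdGauss = ∫ t, h' t ∂stdGauss := by
  have hpdf : ∀ t, HasDerivAt (gaussianPDFReal 0 1) (-t * gaussianPDFReal 0 1 t) t := by
    intro t
    have h1 : HasDerivAt (fun t : ℝ => -(t - 0) ^ 2 / (2 * ((1 : NNReal) : ℝ))) (-t) t := by
      refine ((((hasDerivAt_id t).sub_const (0 : ℝ)).pow 2).neg.div_const
        (2 * ((1 : NNReal) : ℝ))).congr_deriv ?_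
      simp
      ring
    rw [gaussianPDFReal_def]
    refine ((h1.exp).const_mul ((√(2 * π * ((1 : NNReal) : ℝ)))⁻¹)).congr_deriv ?_
    ring
  rw [integral_stdGauss, integral_stdGauss]
  rw [integrable_stdGauss_iff] at hi hi' hti
  have := integral_mul_deriv_eq_deriv_mul_of_integrable (u := gaussianPDFReal 0 1) (v := h)
    (fun t _ => hpdf t) (fun t _ => hd t) hi' (by
      refine hti.neg.congr (Eventually.of_forall fun t => ?_)
      simp
      ring) hi
  rw [this, ← integral_neg]
  congr 1
  ext t
  ring

lemma measurePreserving_update [DecidableEq A] (a : A) :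
    MeasurePreserving (fun q : (A → ℝ) × ℝ => Function.update q.1 a q.2)
      ((stdGaussPi A).prod stdGauss) (stdGaussPi A) := by
  have hm : Measurable fun q : (A → ℝ) × ℝ => Function.update q.1 a q.2 := by
    refine measurable_pi_lambda _ fun b => ?_
    by_cases hb : b = a
    · subst hb; simpa using measurable_snd
    · simp only [Function.update_of_ne hb]; fun_prop
  refine ⟨hm, (Measure.pi_eq fun s hs => ?_).symm⟩
  rw [Measure.map_apply hm (MeasurableSet.univ_pi hs)]
  have : (fun q : (A → ℝ) × ℝ => Function.update q.1 a q.2) ⁻¹' (Set.univ.pi s)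
      = (Set.univ.pi (Function.update s a Set.univ)) ×ˢ (s a) := by
    ext q
    simp only [Set.mem_preimage, Set.mem_pi, Set.mem_univ, true_implies, Set.mem_prod]
    constructor
    · intro h
      refine ⟨fun b => ?_, by simpa using h a⟩
      by_cases hb : b = a
      · subst hb; simp
      · simpa [Function.update_of_ne hb] using h b
    · rintro ⟨h1, h2⟩ b
      by_cases hb : b = a
      · subst hb; simpa using h2
      · simpa [Function.update_of_ne hb] using h1 b
  rw [this, Measure.prod_prod, Measure.pi_pi, ← Finset.prod_erase_mul _ _ (Finset.mem_univ a),
    ← Finset.prod_erase_mul (Finset.univ) (fun i => stdGauss (s i)) (Finset.mem_univ a)]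
  simp only [Function.update_self, measure_univ, mul_one]
  congr 1
  refine Finset.prod_congr rfl fun b hb => ?_
  rw [Function.update_of_ne (Finset.ne_of_mem_erase hb)]

lemma integral_stdGaussPi_update [DecidableEq A] (a : A) {f : (A → ℝ) → ℝ}
    (hf : Integrable f (stdGaussPi A)) :
    ∫ y, f y ∂(stdGaussPi A)
      = ∫ y, ∫ t, f (Function.update y a t) ∂stdGauss ∂(stdGaussPi A) := by
  have hmp := measurePreserving_update a
  have h1 := integral_map (f := f) hmp.measurable.aemeasurable
    (by rw [hmp.map_eq]; exact hf.aestronglyMeasurable)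
  rw [hmp.map_eq] at h1
  rw [h1]
  exact integral_prod _ (hmp.integrable_comp_of_integrable hf)

/-- Gaussian integration by parts in one coordinate. -/
lemma integral_coord_mul_stdGaussPi [DecidableEq A] (a : A) {f f' : (A → ℝ) → ℝ}
    (hd : ∀ y t, HasDerivAt (fun u => f (Function.update y a u)) (f' (Function.update y a t)) t)
    (hi : Integrable f (stdGaussPi A)) (hi' : Integrable f' (stdGaussPi A))
    (hti : Integrable (fun y => y a * f y) (stdGaussPi A)) :
    ∫ y, y a * f y ∂(stdGaussPi A) = ∫ y, f' y ∂(stdGaussPi A) := by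
  rw [integral_stdGaussPi_update a hti, integral_stdGaussPi_update a hi']
  have hmp := measurePreserving_update a
  refine integral_congr_ae ?_
  filter_upwards [(hmp.integrable_comp_of_integrable hi).prod_right_ae,
    (hmp.integrable_comp_of_integrable hi').prod_right_ae,
    (hmp.integrable_comp_of_integrable hti).prod_right_ae] with y h1 h2 h3
  simp only [Function.comp_def, Function.update_self] at h1 h2 h3 ⊢
  exact integral_mul_stdGauss (fun t => hd y t) h1 h2 h3

end Gaussian

section Shift

variable {A : Type*} [Fintype A]

lemma stdGauss_map_add (m : ℝ) :
    stdGauss.map (fun t => t + m)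
      = stdGauss.withDensity fun t => ENNReal.ofReal (exp (m * t - m ^ 2 / 2)) := by
  rw [stdGauss, gaussianReal_map_add_const, gaussianReal_of_var_ne_zero _ one_ne_zero,
    gaussianReal_of_var_ne_zero _ one_ne_zero,
    ← withDensity_mul _ (measurable_gaussianPDF 0 1) (by fun_prop)]
  congr 1
  ext t
  simp only [gaussianPDF, Pi.mul_apply]
  rw [← ENNReal.ofReal_mul (gaussianPDFReal_nonneg _ _ _)]
  congr 1
  simp only [gaussianPDFReal, mul_assoc, ← exp_add]
  congr 3
  push_cast
  ring

lemma stdGaussPi_map_add (m : A → ℝ) :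
    (stdGaussPi A).map (fun y a => y a + m a)
      = (stdGaussPi A).withDensity
          fun y => ENNReal.ofReal (exp (∑ a, (m a * y a - m a ^ 2 / 2))) := by
  have hprob : ∀ a, IsProbabilityMeasure (stdGauss.map (fun t => t + m a)) := fun a =>
    Measure.isProbabilityMeasure_map (by fun_prop)
  rw [Measure.pi_map_pi (f := fun a t => t + m a) (fun a => by fun_prop)]
  refine Measure.pi_eq fun s hs => ?_
  rw [withDensity_apply _ (MeasurableSet.univ_pi hs),
    ← lintegral_indicator (MeasurableSet.univ_pi hs)]
  have hind : ∀ y : A → ℝ, (Set.univ.pi s).indicator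
      (fun y => ENNReal.ofReal (exp (∑ a, (m a * y a - m a ^ 2 / 2)))) y
      = ∏ a, (s a).indicator (fun t => ENNReal.ofReal (exp (m a * t - m a ^ 2 / 2))) (y a) := by
    intro y
    by_cases hy : y ∈ Set.univ.pi s
    · rw [Set.indicator_of_mem hy, exp_sum,
        ENNReal.ofReal_prod_of_nonneg (fun a _ => (exp_pos _).le)]
      refine Finset.prod_congr rfl fun a _ => ?_
      rw [Set.indicator_of_mem (hy a (Set.mem_univ a))]
    · rw [Set.indicator_of_notMem hy]
      simp only [Set.mem_pi, Set.mem_univ, true_implies, not_forall] at hy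
      obtain ⟨a, ha⟩ := hy
      exact (Finset.prod_eq_zero (Finset.mem_univ a) (Set.indicator_of_notMem ha _)).symm
  have hmeas : ∀ a, Measurable
      ((s a).indicator fun t => ENNReal.ofReal (exp (m a * t - m a ^ 2 / 2))) := fun a =>
    Measurable.indicator (by fun_prop) (hs a)
  simp_rw [hind]
  rw [lintegral_prod_eq_prod_lintegral_of_indepFun Finset.univ
    (fun a (y : A → ℝ) => (s a).indicator
      (fun t => ENNReal.ofReal (exp (m a * t - m a ^ 2 / 2))) (y a))
    (iIndepFun_pi (μ := fun _ : A => stdGauss) fun a => (hmeas a).aemeasurable)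
    fun a => (hmeas a).comp (measurable_pi_apply a)]
  refine Finset.prod_congr rfl fun a _ => ?_
  rw [stdGauss_map_add, withDensity_apply _ (hs a), ← lintegral_indicator (hs a)]
  exact (measurePreserving_eval (fun _ : A => stdGauss) a).lintegral_comp (hmeas a)

/-- Translation of the product Gaussian measure, with the corresponding change of density. -/
lemma integral_stdGaussPi_add (m : A → ℝ) {f : (A → ℝ) → ℝ} (hf : Measurable f) :
    ∫ y, f (fun a => y a + m a) ∂(stdGaussPi A)
      = ∫ y, exp (∑ a, (m a * y a - m a ^ 2 / 2)) * f y ∂(stdGaussPi A) := by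
  rw [← integral_map (φ := fun (y : A → ℝ) a => y a + m a)
    (Measurable.aemeasurable (by fun_prop)) hf.aestronglyMeasurable, stdGaussPi_map_add,
    integral_withDensity_eq_integral_toReal_smul (by fun_prop)
      (Eventually.of_forall fun _ => ENNReal.ofReal_lt_top)]
  simp [ENNReal.toReal_ofReal (exp_pos _).le]

end Shift

section Channel

variable {A Ω Θ : Type*} [Fintype A]

/-- The likelihood ratio, at the observation `y`, of the signal `u` sent through independent
Gaussian channels with amplitudes `c`. -/
def likelihood (c u y : A → ℝ) : ℝ :=
  exp (∑ a, (c a * u a * y a - (c a * u a) ^ 2 / 2))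

/-- The unnormalized posterior average of `g`. -/
def posteriorSum (T : Finset Ω) (p : Ω → ℝ) (s : Ω → A → ℝ) (g : Ω → ℝ) (c y : A → ℝ) : ℝ :=
  ∑ x ∈ T, p x * likelihood c (s x) y * g x

/-- The likelihood of the observation, averaged over the prior. -/
abbrev evidence (T : Finset Ω) (p : Ω → ℝ) (s : Ω → A → ℝ) (c y : A → ℝ) : ℝ :=
  posteriorSum T p s (fun _ => 1) c y

/-- The relative entropy of the observation with respect to pure noise. -/
def channelEntropy (T : Finset Ω) (p : Ω → ℝ) (s : Ω → A → ℝ) (c : A → ℝ) : ℝ :=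
  ∫ y, evidence T p s c y * log (evidence T p s c y) ∂(stdGaussPi A)

lemma likelihood_pos (c u y : A → ℝ) : 0 < likelihood c u y := exp_pos _

lemma continuous_likelihood (c u : A → ℝ) : Continuous (likelihood c u) := by
  unfold likelihood; fun_prop

lemma continuous_posteriorSum (T : Finset Ω) (p : Ω → ℝ) (s : Ω → A → ℝ) (g : Ω → ℝ)
    (c : A → ℝ) : Continuous (posteriorSum T p s g c) := by
  have := fun x => continuous_likelihood c (s x)
  unfold posteriorSum; fun_prop

lemma abs_likelihood_exponent_le {c u : A → ℝ} {B : ℝ} (h : ∀ a, |c a * u a| ≤ B) (y : A → ℝ) :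
    |∑ a, (c a * u a * y a - (c a * u a) ^ 2 / 2)|
      ≤ Fintype.card A * (B ^ 2 / 2) + B * ∑ a, |y a| := by
  calc |∑ a, (c a * u a * y a - (c a * u a) ^ 2 / 2)|
      ≤ ∑ a, |c a * u a * y a - (c a * u a) ^ 2 / 2| := Finset.abs_sum_le_sum_abs _ _
    _ ≤ ∑ a, (B ^ 2 / 2 + B * |y a|) := by
        refine Finset.sum_le_sum fun a _ => (abs_sub _ _).trans ?_
        have h1 : (c a * u a) ^ 2 ≤ B ^ 2 := sq_le_sq' (abs_le.1 (h a)).1 (abs_le.1 (h a)).2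
        rw [abs_mul, abs_of_nonneg (by positivity : 0 ≤ (c a * u a) ^ 2 / 2)]
        have := mul_le_mul_of_nonneg_right (h a) (abs_nonneg (y a))
        linarith
    _ = _ := by simp [Finset.sum_add_distrib, Finset.mul_sum]

variable {T : Finset Ω} {p : Ω → ℝ} {s : Ω → A → ℝ} {c : Θ → A → ℝ} {B : ℝ}

lemma expGrowth_likelihood {u : A → ℝ} (hB : ∀ θ a, |c θ a * u a| ≤ B) :
    ExpGrowth fun θ y => likelihood (c θ) u y :=
  ExpGrowth.exp_of_le fun θ y => (le_abs_self _).trans (abs_likelihood_exponent_le (hB θ) y)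

lemma expGrowth_posteriorSum (hB : ∀ x ∈ T, ∀ θ a, |c θ a * s x a| ≤ B) (g : Ω → ℝ) :
    ExpGrowth fun θ y => posteriorSum T p s g (c θ) y :=
  ExpGrowth.sum T fun x hx =>
    ((ExpGrowth.of_bounded (C := |p x|) fun _ _ => le_rfl).mul (expGrowth_likelihood (hB x hx))).mul
      (ExpGrowth.of_bounded (C := |g x|) fun _ _ => le_rfl)

lemma evidence_mem_Icc (hp : ∀ x ∈ T, 0 ≤ p x) (hp1 : ∑ x ∈ T, p x = 1)
    (hB : ∀ x ∈ T, ∀ θ a, |c θ a * s x a| ≤ B) (θ : Θ) (y : A → ℝ) :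
    evidence T p s (c θ) y ∈ Set.Icc
      (exp (-(Fintype.card A * (B ^ 2 / 2) + B * ∑ a, |y a|)))
      (exp (Fintype.card A * (B ^ 2 / 2) + B * ∑ a, |y a|)) := by
  unfold evidence posteriorSum
  simp only [mul_one]
  set R := (Fintype.card A * (B ^ 2 / 2) + B * ∑ a, |y a|)
  have hx : ∀ x ∈ T, exp (-R) ≤ likelihood (c θ) (s x) y ∧ likelihood (c θ) (s x) y ≤ exp R := by
    intro x hx
    have := abs_le.1 (abs_likelihood_exponent_le (hB x hx θ) y)
    exact ⟨exp_le_exp.2 this.1, exp_le_exp.2 this.2⟩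
  constructor
  · calc exp (-R) = ∑ x ∈ T, p x * exp (-R) := by rw [← Finset.sum_mul, hp1, one_mul]
      _ ≤ _ := Finset.sum_le_sum fun x h => mul_le_mul_of_nonneg_left (hx x h).1 (hp x h)
  · calc _ ≤ ∑ x ∈ T, p x * exp R :=
          Finset.sum_le_sum fun x h => mul_le_mul_of_nonneg_left (hx x h).2 (hp x h)
      _ = exp R := by rw [← Finset.sum_mul, hp1, one_mul]

lemma evidence_pos (hp : ∀ x ∈ T, 0 ≤ p x) (hp1 : ∑ x ∈ T, p x = 1) (c y : A → ℝ) :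
    0 < evidence T p s c y := by
  unfold evidence posteriorSum
  simp only [mul_one]
  obtain ⟨x, hx, hx0⟩ : ∃ x ∈ T, p x ≠ 0 := by
    by_contra! h
    rw [Finset.sum_eq_zero h] at hp1
    exact zero_ne_one hp1
  refine Finset.sum_pos' (fun x hx => mul_nonneg (hp x hx) (likelihood_pos _ _ _).le) ⟨x, hx, ?_⟩
  exact mul_pos (lt_of_le_of_ne (hp x hx) hx0.symm) (likelihood_pos _ _ _)

lemma expGrowth_log_evidence (hp : ∀ x ∈ T, 0 ≤ p x) (hp1 : ∑ x ∈ T, p x = 1)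
    (hB : ∀ x ∈ T, ∀ θ a, |c θ a * s x a| ≤ B) :
    ExpGrowth fun θ y => log (evidence T p s (c θ) y) := by
  refine ExpGrowth.of_abs_le (D := Fintype.card A * (B ^ 2 / 2)) (k := B) fun θ y => ?_
  have h := evidence_mem_Icc hp hp1 hB θ y
  have h0 := evidence_pos (s := s) hp hp1 (c θ) y
  exact abs_le.2 ⟨(le_log_iff_exp_le h0).2 h.1, (log_le_iff_le_exp h0).2 h.2⟩

lemma expGrowth_inv_evidence (hp : ∀ x ∈ T, 0 ≤ p x) (hp1 : ∑ x ∈ T, p x = 1)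
    (hB : ∀ x ∈ T, ∀ θ a, |c θ a * s x a| ≤ B) :
    ExpGrowth fun θ y => (evidence T p s (c θ) y)⁻¹ := by
  refine (ExpGrowth.exp_of_le (g := fun θ y => Fintype.card A * (B ^ 2 / 2) + B * ∑ a, |y a|)
    fun _ _ => le_rfl).mono fun θ y => ?_
  have h := evidence_mem_Icc hp hp1 hB θ y
  have h0 := evidence_pos (s := s) hp hp1 (c θ) y
  rw [abs_exp, abs_of_pos (inv_pos.2 h0)]
  exact inv_le_of_inv_le₀ (exp_pos _) (by rw [← exp_neg]; exact h.1)

lemma continuous_log_evidence (hp : ∀ x ∈ T, 0 ≤ p x) (hp1 : ∑ x ∈ T, p x = 1) (c : A → ℝ) :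
    Continuous fun y => log (evidence T p s c y) :=
  (continuous_posteriorSum T p s _ c).log fun y => (evidence_pos hp hp1 c y).ne'

/-- The amplitudes times the signals are bounded, as there are finitely many of them. -/
lemma exists_signal_bound (T : Finset Ω) (s : Ω → A → ℝ) {B : ℝ} (hc : ∀ θ a, |c θ a| ≤ B) :
    ∃ B', ∀ x ∈ T, ∀ θ a, |c θ a * s x a| ≤ B' := by
  refine ⟨∑ x ∈ T, ∑ a, B * |s x a|, fun x hx θ a => ?_⟩
  have hB : ∀ x a, 0 ≤ B * |s x a| := fun x a =>
    mul_nonneg ((abs_nonneg _).trans (hc θ a)) (abs_nonneg _)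
  rw [abs_mul]
  calc |c θ a| * |s x a| ≤ B * |s x a| := by gcongr; exact hc θ a
    _ ≤ ∑ a, B * |s x a| :=
        Finset.single_le_sum (f := fun a => B * |s x a|) (fun a _ => hB x a) (Finset.mem_univ a)
    _ ≤ _ := Finset.single_le_sum (f := fun x => ∑ a, B * |s x a|)
        (fun x _ => Finset.sum_nonneg fun a _ => hB x a) hx

lemma exists_abs_le (c : A → ℝ) : ∃ B, ∀ (_ : Unit) a, |c a| ≤ B :=
  ⟨∑ a, |c a|, fun _ a =>
    Finset.single_le_sum (f := fun a => |c a|) (fun _ _ => abs_nonneg _) (Finset.mem_univ a)⟩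

lemma integral_evidence (hp1 : ∑ x ∈ T, p x = 1) (c : A → ℝ) :
    ∫ y, evidence T p s c y ∂(stdGaussPi A) = 1 := by
  obtain ⟨B, hB⟩ := exists_abs_le c
  obtain ⟨B', hB'⟩ := exists_signal_bound T s hB
  unfold evidence posteriorSum
  simp only [mul_one]
  rw [integral_finsetSum]
  · rw [← hp1]
    refine Finset.sum_congr rfl fun x _ => ?_
    have := integral_stdGaussPi_add (fun a => c a * s x a) (f := fun _ => 1) measurable_const
    rw [integral_const_mul]
    simp only [mul_one, integral_const, probReal_univ, smul_eq_mul] at this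
    unfold likelihood
    rw [← this, mul_one]
  · intro x hx
    exact ((expGrowth_likelihood (hB' x hx)).integrable () (continuous_likelihood _ _)).const_mul _

/-- The averaged log-likelihood of the planted model is a relative entropy. -/
lemma sum_integral_log_eq_channelEntropy (hp : ∀ x ∈ T, 0 ≤ p x) (hp1 : ∑ x ∈ T, p x = 1)
    (c : A → ℝ) :
    ∑ X ∈ T, p X * ∫ z, log (∑ x ∈ T, p x * exp (∑ a, (c a * s x a * z a
        + c a ^ 2 * s X a * s x a - (c a * s x a) ^ 2 / 2))) ∂(stdGaussPi A)
      = channelEntropy T p s c := by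
  obtain ⟨B, hB⟩ := exists_abs_le c
  obtain ⟨B', hB'⟩ := exists_signal_bound T s hB
  have hX : ∀ X ∈ T, (∫ z, log (∑ x ∈ T, p x * exp (∑ a, (c a * s x a * z a
        + c a ^ 2 * s X a * s x a - (c a * s x a) ^ 2 / 2))) ∂(stdGaussPi A))
      = ∫ y, likelihood c (s X) y * log (evidence T p s c y) ∂(stdGaussPi A) := by
    intro X hX
    have := integral_stdGaussPi_add (fun a => c a * s X a)
      (continuous_log_evidence (s := s) hp hp1 c).measurable
    unfold likelihood
    rw [← this]
    unfold evidence posteriorSum likelihood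
    congr 1
    ext z
    congr 1
    refine Finset.sum_congr rfl fun x _ => ?_
    rw [mul_one]
    congr 2
    refine Finset.sum_congr rfl fun a _ => ?_
    ring
  rw [Finset.sum_congr rfl fun X h => by rw [hX X h]]
  simp_rw [← integral_const_mul]
  rw [← integral_finsetSum]
  · unfold channelEntropy
    congr 1
    ext y
    have he : evidence T p s c y = ∑ x ∈ T, p x * likelihood c (s x) y := by
      simp [evidence, posteriorSum]
    simp_rw [← mul_assoc]
    rw [← Finset.sum_mul, ← he]
  · intro X hX
    refine Integrable.const_mul ?_ _
    exact ((expGrowth_likelihood (hB' X hX)).mul (expGrowth_log_evidence hp hp1 hB')).integrable ()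
      ((continuous_likelihood _ _).mul (continuous_log_evidence hp hp1 c))

end Channel

section Derivative

variable {A Ω : Type*} [Fintype A] {T : Finset Ω} {p : Ω → ℝ} {s : Ω → A → ℝ}

lemma hasDerivAt_likelihood_coord [DecidableEq A] (c u y : A → ℝ) (a : A) (t : ℝ) :
    HasDerivAt (fun t => likelihood c u (Function.update y a t))
      (likelihood c u (Function.update y a t) * (c a * u a)) t := by
  unfold likelihood
  refine HasDerivAt.exp ?_
  have h : ∀ b ∈ Finset.univ, HasDerivAt
      (fun t => c b * u b * Function.update y a t b - (c b * u b) ^ 2 / 2)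
      (c b * u b * (Pi.single a (1 : ℝ) : A → ℝ) b) t := fun b _ =>
    ((hasDerivAt_pi.1 (hasDerivAt_update y a t) b).const_mul (c b * u b)).sub_const _
  refine (HasDerivAt.fun_sum h).congr_deriv ?_
  simp [Pi.single_apply]

lemma hasDerivAt_posteriorSum_coord [DecidableEq A] (g : Ω → ℝ) (c y : A → ℝ) (a : A) (t : ℝ) :
    HasDerivAt (fun t => posteriorSum T p s g c (Function.update y a t))
      (c a * posteriorSum T p s (fun x => g x * s x a) c (Function.update y a t)) t := by
  unfold posteriorSum
  refine (HasDerivAt.fun_sum fun x _ =>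
    ((hasDerivAt_likelihood_coord c (s x) y a t).const_mul (p x)).mul_const (g x)).congr_deriv ?_
  rw [Finset.mul_sum]
  refine Finset.sum_congr rfl fun x _ => ?_
  ring

lemma hasDerivAt_evidence {c c' : ℝ → A → ℝ} {θ : ℝ}
    (hd : ∀ a, HasDerivAt (fun θ => c θ a) (c' θ a) θ) (y : A → ℝ) :
    HasDerivAt (fun θ => evidence T p s (c θ) y)
      (∑ a, c' θ a * (y a * posteriorSum T p s (fun x => s x a) (c θ) y
        - c θ a * posteriorSum T p s (fun x => s x a * s x a) (c θ) y)) θ := by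
  have hl : ∀ u : A → ℝ, HasDerivAt (fun θ => likelihood (c θ) u y)
      (likelihood (c θ) u y * ∑ a, (c' θ a * u a * y a - c θ a * c' θ a * (u a * u a))) θ := by
    intro u
    unfold likelihood
    refine HasDerivAt.exp ?_
    refine (HasDerivAt.fun_sum fun a _ => (((hd a).mul_const (u a)).mul_const (y a)).sub
      ((((hd a).mul_const (u a)).pow 2).div_const 2)).congr_deriv ?_
    refine Finset.sum_congr rfl fun a _ => ?_
    simp
    ring
  unfold evidence posteriorSum
  refine (HasDerivAt.fun_sum fun x _ =>
    ((hl (s x)).const_mul (p x)).mul_const 1).congr_deriv ?_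
  simp_rw [Finset.mul_sum, ← Finset.sum_sub_distrib, Finset.mul_sum, Finset.sum_mul]
  rw [Finset.sum_comm]
  refine Finset.sum_congr rfl fun a _ => Finset.sum_congr rfl fun x _ => ?_
  ring

/-- Derivative of the channel entropy along a path of amplitudes. -/
lemma hasDerivAt_channelEntropy (hp : ∀ x ∈ T, 0 ≤ p x) (hp1 : ∑ x ∈ T, p x = 1)
    {c c' : ℝ → A → ℝ} {B₀ : ℝ} (hd : ∀ θ a, HasDerivAt (fun θ => c θ a) (c' θ a) θ)
    (hc : ∀ θ a, |c θ a| ≤ B₀) (hc' : ∀ θ a, |c' θ a| ≤ B₀) (θ : ℝ) :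
    HasDerivAt (fun θ => channelEntropy T p s (c θ))
      (∫ y, (∑ a, c' θ a * c θ a * posteriorSum T p s (fun x => s x a) (c θ) y ^ 2)
        * (evidence T p s (c θ) y)⁻¹ ∂(stdGaussPi A)) θ := by
  classical
  obtain ⟨B, hB⟩ := exists_signal_bound T s hc
  have hS := fun g => expGrowth_posteriorSum (p := p) hB g
  have hSc := fun g θ => continuous_posteriorSum T p s g (c θ)
  have hL := expGrowth_log_evidence hp hp1 hB
  have hLc := fun θ => continuous_log_evidence (s := s) hp hp1 (c θ)
  have hI := expGrowth_inv_evidence hp hp1 hB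
  have hpos := fun θ y => evidence_pos (s := s) hp hp1 (c θ) y
  have hIc : ∀ θ, Continuous fun y => (evidence T p s (c θ) y)⁻¹ := fun θ =>
    (hSc _ θ).inv₀ fun y => (hpos θ y).ne'
  have h1 : ExpGrowth fun (_ : ℝ) (_ : A → ℝ) => (1 : ℝ) :=
    ExpGrowth.of_bounded (C := 1) (by simp)
  have hm1 : ExpGrowth fun (_ : ℝ) (_ : A → ℝ) => (-1 : ℝ) :=
    ExpGrowth.of_bounded (C := 1) (by simp)
  have hcg : ∀ a, ExpGrowth fun θ (_ : A → ℝ) => c θ a := fun a =>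
    ExpGrowth.of_bounded fun θ _ => hc θ a
  have hcg' : ∀ a, ExpGrowth fun θ (_ : A → ℝ) => c' θ a := fun a =>
    ExpGrowth.of_bounded fun θ _ => hc' θ a
  set G : ℝ → (A → ℝ) → ℝ := fun θ y => (log (evidence T p s (c θ) y) + 1) *
    ∑ a, c' θ a * (y a * posteriorSum T p s (fun x => s x a) (c θ) y
      - c θ a * posteriorSum T p s (fun x => s x a * s x a) (c θ) y) with hG
  have hGg : ExpGrowth G := by
    refine (hL.add h1).mul (ExpGrowth.sum _ fun a _ => (hcg' a).mul ?_)
    simp_rw [sub_eq_add_neg, neg_eq_neg_one_mul (c _ a * _)]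
    exact ((ExpGrowth.coord a).mul (hS _)).add (hm1.mul ((hcg a).mul (hS _)))
  have hGc : ∀ θ, Continuous (G θ) := by
    intro θ
    refine ((hLc θ).add continuous_const).mul (continuous_finsetSum _ fun a _ => ?_)
    exact continuous_const.mul (((continuous_apply a).mul (hSc _ θ)).sub
      (continuous_const.mul (hSc _ θ)))
  have hGd : ∀ y θ, HasDerivAt
      (fun θ => evidence T p s (c θ) y * log (evidence T p s (c θ) y)) (G θ y) θ := by
    intro y θ
    have h := hasDerivAt_evidence (T := T) (p := p) (s := s) (hd θ) y
    refine (h.mul (h.log (hpos θ y).ne')).congr_deriv ?_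
    rw [mul_div_cancel₀ _ (hpos θ y).ne', hG]
    ring
  have hderiv : HasDerivAt (fun θ => channelEntropy T p s (c θ)) (∫ y, G θ y ∂(stdGaussPi A)) θ := by
    obtain ⟨C, k, hC, hk, hb⟩ := id hGg
    have hint : Integrable (fun y => evidence T p s (c θ) y * log (evidence T p s (c θ) y))
        (stdGaussPi A) := ((hS fun _ => 1).mul hL).integrable θ ((hSc _ θ).mul (hLc θ))
    have hmeas : ∀ θ, AEStronglyMeasurable
        (fun y => evidence T p s (c θ) y * log (evidence T p s (c θ) y)) (stdGaussPi A) :=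
      fun θ => ((hSc (fun _ => 1) θ).mul (hLc θ)).aestronglyMeasurable
    have := hasDerivAt_integral_of_dominated_loc_of_deriv_le (s := Set.univ) (x₀ := θ)
      (F := fun θ y => evidence T p s (c θ) y * log (evidence T p s (c θ) y)) (F' := G)
      (bound := fun y => C * exp (k * ∑ a, |y a|)) Filter.univ_mem
      (Eventually.of_forall hmeas) hint
      (hGc θ).aestronglyMeasurable (Eventually.of_forall fun y θ _ => hb θ y)
      ((integrable_exp_mul_sum_abs k).const_mul C)
      (Eventually.of_forall fun y θ _ => hGd y θ)
    exact this.2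
  refine hderiv.congr_deriv ?_
  -- the terms of the sum over coordinates, before and after integration by parts
  set f : A → ℝ → (A → ℝ) → ℝ := fun a θ y =>
    (log (evidence T p s (c θ) y) + 1) * posteriorSum T p s (fun x => s x a) (c θ) y with hf
  set r : A → ℝ → (A → ℝ) → ℝ := fun a θ y => (log (evidence T p s (c θ) y) + 1)
    * (c θ a * posteriorSum T p s (fun x => s x a * s x a) (c θ) y) with hr
  set w : A → ℝ → (A → ℝ) → ℝ := fun a θ y =>
    c θ a * posteriorSum T p s (fun x => s x a) (c θ) y ^ 2 * (evidence T p s (c θ) y)⁻¹ with hw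
  have hfi : ∀ a, Integrable (f a θ) (stdGaussPi A) := fun a =>
    ((hL.add h1).mul (hS _)).integrable θ (((hLc θ).add continuous_const).mul (hSc _ θ))
  have hyfi : ∀ a, Integrable (fun y => y a * f a θ y) (stdGaussPi A) := fun a =>
    ((ExpGrowth.coord a).mul ((hL.add h1).mul (hS fun x => s x a))).integrable θ
      ((continuous_apply a).mul (((hLc θ).add continuous_const).mul (hSc _ θ)))
  have hri : ∀ a, Integrable (r a θ) (stdGaussPi A) := fun a =>
    ((hL.add h1).mul ((hcg a).mul (hS _))).integrable θ
      (((hLc θ).add continuous_const).mul (continuous_const.mul (hSc _ θ)))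
  have hwi : ∀ a, Integrable (w a θ) (stdGaussPi A) := by
    intro a
    have := (((hcg a).mul ((hS fun x => s x a).mul (hS fun x => s x a))).mul hI).integrable θ
      ((continuous_const.mul ((hSc _ θ).mul (hSc _ θ))).mul (hIc θ))
    simpa only [hw, pow_two] using this
  have hparts : ∀ a, ∫ y, y a * f a θ y ∂(stdGaussPi A)
      = ∫ y, (w a θ y + r a θ y) ∂(stdGaussPi A) := by
    intro a
    refine integral_coord_mul_stdGaussPi a (fun y t => ?_) (hfi a) ((hwi a).add (hri a)) (hyfi a)
    have hE := hasDerivAt_posteriorSum_coord (T := T) (p := p) (s := s) (fun _ => 1) (c θ) y a t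
    have hg := hasDerivAt_posteriorSum_coord (T := T) (p := p) (s := s) (fun x => s x a) (c θ) y a t
    refine (((hE.log (hpos θ _).ne').add_const 1).mul hg).congr_deriv ?_
    simp only [hw, hr, one_mul, evidence]
    ring
  have hGsum : ∀ y, G θ y = ∑ a, c' θ a * (y a * f a θ y - r a θ y) := by
    intro y
    simp only [hG, hf, hr, Finset.mul_sum]
    refine Finset.sum_congr rfl fun a _ => ?_
    ring
  simp_rw [hGsum]
  have hdi : ∀ a, Integrable (fun y => c' θ a * (y a * f a θ y - r a θ y)) (stdGaussPi A) :=
    fun a => ((hyfi a).sub (hri a)).const_mul (c' θ a)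
  rw [integral_finsetSum _ fun a _ => hdi a]
  have hterm : ∀ a, ∫ y, c' θ a * (y a * f a θ y - r a θ y) ∂(stdGaussPi A)
      = ∫ y, c' θ a * w a θ y ∂(stdGaussPi A) := by
    intro a
    rw [integral_const_mul, integral_const_mul, integral_sub (hyfi a) (hri a), hparts a,
      integral_add (hwi a) (hri a), add_sub_cancel_right]
  rw [Finset.sum_congr rfl fun a _ => hterm a,
    ← integral_finsetSum _ fun a _ => (hwi a).const_mul (c' θ a)]
  congr 1
  ext y
  rw [Finset.sum_mul]
  refine Finset.sum_congr rfl fun a _ => ?_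
  simp only [hw]
  ring

lemma integrable_sum_sq_mul_inv_evidence (hp : ∀ x ∈ T, 0 ≤ p x) (hp1 : ∑ x ∈ T, p x = 1)
    (b c : A → ℝ) :
    Integrable (fun y => (∑ a, b a * posteriorSum T p s (fun x => s x a) c y ^ 2)
      * (evidence T p s c y)⁻¹) (stdGaussPi A) := by
  obtain ⟨B, hB⟩ := exists_abs_le c
  obtain ⟨B', hB'⟩ := exists_signal_bound T s hB
  have hS := fun g => expGrowth_posteriorSum (p := p) hB' g
  have hSc := fun g => continuous_posteriorSum T p s g c
  simp_rw [pow_two]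
  refine ((ExpGrowth.sum _ fun a _ => (ExpGrowth.of_bounded (C := |b a|) fun _ _ => le_rfl).mul
    ((hS fun x => s x a).mul (hS fun x => s x a))).mul
    (expGrowth_inv_evidence hp hp1 hB')).integrable () ?_
  exact (continuous_finsetSum _ fun a _ => continuous_const.mul ((hSc _).mul (hSc _))).mul
    ((hSc _).inv₀ fun y => (evidence_pos hp hp1 c y).ne')

lemma integrable_evidence (c : A → ℝ) : Integrable (evidence T p s c) (stdGaussPi A) := by
  obtain ⟨B, hB⟩ := exists_abs_le c
  obtain ⟨B', hB'⟩ := exists_signal_bound T s hB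
  exact (expGrowth_posteriorSum hB' fun _ => 1).integrable () (continuous_posteriorSum T p s _ c)

/-- A pointwise lower bound on the quadratic form integrates to a lower bound. -/
lemma le_integral_of_mul_evidence_sq_le (hp : ∀ x ∈ T, 0 ≤ p x) (hp1 : ∑ x ∈ T, p x = 1)
    {b c : A → ℝ} {m : ℝ}
    (h : ∀ y, m * evidence T p s c y ^ 2
      ≤ ∑ a, b a * posteriorSum T p s (fun x => s x a) c y ^ 2) :
    m ≤ ∫ y, (∑ a, b a * posteriorSum T p s (fun x => s x a) c y ^ 2)
      * (evidence T p s c y)⁻¹ ∂(stdGaussPi A) := by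
  calc m = ∫ y, m * evidence T p s c y ∂(stdGaussPi A) := by
        rw [integral_const_mul, integral_evidence hp1, mul_one]
    _ ≤ _ := by
        refine integral_mono ((integrable_evidence c).const_mul m)
          (integrable_sum_sq_mul_inv_evidence hp hp1 b c) fun y => ?_
        have h0 := evidence_pos (s := s) hp hp1 c y
        have := mul_le_mul_of_nonneg_right (h y) (inv_pos.2 h0).le
        calc m * evidence T p s c y
            = m * evidence T p s c y ^ 2 * (evidence T p s c y)⁻¹ := by field_simp
          _ ≤ _ := this

end Derivative

section FiniteSupport

variable {Ω : Type*} [MeasurableSpace Ω] {μ : Measure Ω}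
  {T : Finset Ω}

lemma restrict_finset_of_null (hT : μ ((↑T : Set Ω)ᶜ) = 0) : μ.restrict (↑T : Set Ω) = μ :=
  Measure.restrict_eq_self_of_ae_mem (mem_ae_iff.2 hT)

lemma pi_piFinset_compl_null {ι : Type*} [Fintype ι] [DecidableEq ι] [IsProbabilityMeasure μ]
    (hT : μ ((↑T : Set Ω)ᶜ) = 0) :
    (Measure.pi fun _ : ι => μ) ((↑(Fintype.piFinset fun _ : ι => T) : Set (ι → Ω))ᶜ) = 0 := by
  rw [← mem_ae_iff]
  have : ∀ᵐ x ∂(Measure.pi fun _ : ι => μ), ∀ i, x i ∈ T := by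
    rw [ae_all_iff]
    intro i
    exact (measurePreserving_eval (fun _ : ι => μ) i).quasiMeasurePreserving.ae
      (mem_ae_iff.2 hT : ∀ᵐ x ∂μ, x ∈ T)
  filter_upwards [this] with x hx
  simpa using hx

variable [MeasurableSingletonClass Ω]

lemma integrable_of_finset_support [IsFiniteMeasure μ] (hT : μ ((↑T : Set Ω)ᶜ) = 0) (f : Ω → ℝ) :
    Integrable f μ := by
  rw [← restrict_finset_of_null hT]
  exact IntegrableOn.finset

lemma integral_of_finset_support [IsFiniteMeasure μ] (hT : μ ((↑T : Set Ω)ᶜ) = 0) (f : Ω → ℝ) :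
    ∫ x, f x ∂μ = ∑ x ∈ T, μ.real {x} * f x := by
  conv_lhs => rw [← restrict_finset_of_null hT]
  rw [setIntegral_finset T IntegrableOn.finset]
  simp

lemma sum_real_of_finset_support [IsProbabilityMeasure μ] (hT : μ ((↑T : Set Ω)ᶜ) = 0) :
    ∑ x ∈ T, μ.real {x} = 1 := by
  have := integral_of_finset_support hT fun _ => (1 : ℝ)
  simpa using this.symm

/-- The planted free energy of a finitely supported prior is a relative entropy. -/
lemma integral_integral_log_eq_channelEntropy {A : Type*} [Fintype A] [IsProbabilityMeasure μ]
    (hT : μ ((↑T : Set Ω)ᶜ) = 0) (s : Ω → A → ℝ) (c : A → ℝ) :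
    ∫ X, (∫ z, log (∫ x, exp (∑ a, (c a * s x a * z a
        + c a ^ 2 * s X a * s x a - (c a * s x a) ^ 2 / 2)) ∂μ) ∂(stdGaussPi A)) ∂μ
      = channelEntropy T (fun x => μ.real {x}) s c := by
  rw [← sum_integral_log_eq_channelEntropy (fun _ _ => measureReal_nonneg)
    (sum_real_of_finset_support hT)]
  simp_rw [integral_of_finset_support hT]

end FiniteSupport

section Overlap

variable {n : ℕ} {T : Finset (Fin n → ℝ)} {w : (Fin n → ℝ) → ℝ} {K : ℝ}

lemma sum_sq_of_products {ι Ω : Type*} [Fintype ι] (T : Finset Ω) (w : Ω → ℝ) (v : Ω → ι → ℝ) :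
    ∑ i, (∑ x ∈ T, w x * v x i) ^ 2
      = ∑ x ∈ T, ∑ y ∈ T, w x * w y * ∑ i, v x i * v y i := by
  simp_rw [pow_two, Finset.sum_mul_sum, Finset.mul_sum]
  rw [Finset.sum_comm]
  refine Finset.sum_congr rfl fun x _ => ?_
  rw [Finset.sum_comm]
  refine Finset.sum_congr rfl fun y _ => Finset.sum_congr rfl fun i _ => ?_
  ring

lemma sum_pairs_eq {f : Fin n × Fin n → ℝ} (hf : ∀ i j, f (i, j) = f (j, i)) :
    ∑ p, (if p.1 < p.2 then f p else 0) = (∑ p, f p - ∑ i, f (i, i)) / 2 := by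
  have hswap : ∑ p : Fin n × Fin n, (if p.2 < p.1 then f p else 0)
      = ∑ p, (if p.1 < p.2 then f p else 0) :=
    Fintype.sum_equiv (Equiv.prodComm _ _) _ _ fun p => by
      by_cases h : p.2 < p.1
      · rw [if_pos h, if_pos (by simpa using h)]
        exact hf p.1 p.2
      · rw [if_neg h, if_neg (by simpa using h)]
  have hdiag : ∑ p : Fin n × Fin n, (if p.1 = p.2 then f p else 0) = ∑ i, f (i, i) := by
    rw [Fintype.sum_prod_type]
    simp
  have hsplit : ∑ p, f p = ∑ p : Fin n × Fin n, (if p.1 < p.2 then f p else 0)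
      + ∑ p : Fin n × Fin n, (if p.2 < p.1 then f p else 0)
      + ∑ p : Fin n × Fin n, (if p.1 = p.2 then f p else 0) := by
    rw [← Finset.sum_add_distrib, ← Finset.sum_add_distrib]
    refine Finset.sum_congr rfl fun p _ => ?_
    rcases lt_trichotomy p.1 p.2 with h | h | h
    · simp [h, h.not_gt, h.ne]
    · simp [h]
    · simp [h, h.not_gt, h.ne']
  linarith

lemma sq_sum_mul_le (hw : ∀ x ∈ T, 0 ≤ w x) {v : (Fin n → ℝ) → ℝ} (hv : ∀ x ∈ T, |v x| ≤ K ^ 2) :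
    (∑ x ∈ T, w x * v x) ^ 2 ≤ K ^ 4 * (∑ x ∈ T, w x) ^ 2 := by
  have h : |∑ x ∈ T, w x * v x| ≤ K ^ 2 * ∑ x ∈ T, w x := by
    refine (Finset.abs_sum_le_sum_abs _ _).trans ?_
    rw [Finset.mul_sum]
    refine Finset.sum_le_sum fun x hx => ?_
    rw [abs_mul, abs_of_nonneg (hw x hx), mul_comm]
    exact mul_le_mul_of_nonneg_right (hv x hx) (hw x hx)
  calc _ = |∑ x ∈ T, w x * v x| ^ 2 := (sq_abs _).symm
    _ ≤ (K ^ 2 * ∑ x ∈ T, w x) ^ 2 := by gcongr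
    _ = _ := by ring

lemma abs_mul_le_sq {a b : ℝ} (ha : |a| ≤ K) (hb : |b| ≤ K) : |a * b| ≤ K ^ 2 := by
  rw [abs_mul, pow_two]
  exact mul_le_mul ha hb (abs_nonneg _) ((abs_nonneg _).trans ha)

/-- Completing the square in the overlap of two replicas. -/
lemma overlap_lower_bound (hn : 0 < n) {lam q : ℝ} (hlam : 0 < lam)
    (hw : ∀ x ∈ T, 0 ≤ w x) (hT : ∀ x ∈ T, ∀ i, |x i| ≤ K) :
    -(lam * n * q ^ 2 / 2 + lam * K ^ 4 / 2) * (∑ x ∈ T, w x) ^ 2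
      ≤ ∑ p : Fin n × Fin n,
          (if p.1 < p.2 then lam / n else 0) * (∑ x ∈ T, w x * (x p.1 * x p.2)) ^ 2
        + ∑ i, -(lam * q) * (∑ x ∈ T, w x * x i) ^ 2 := by
  have hn' : (0 : ℝ) < n := by exact_mod_cast hn
  set A : Fin n × Fin n → ℝ := fun p => (∑ x ∈ T, w x * (x p.1 * x p.2)) ^ 2 with hA
  have hpairs : ∑ p : Fin n × Fin n, (if p.1 < p.2 then lam / n else 0) * A p
      = lam / n * ((∑ p, A p - ∑ i, A (i, i)) / 2) := by
    rw [← sum_pairs_eq (f := A) (fun i j => by simp only [hA, mul_comm]), Finset.mul_sum]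
    refine Finset.sum_congr rfl fun p _ => ?_
    split_ifs <;> simp
  have hdiag : ∑ i, A (i, i) ≤ n * (K ^ 4 * (∑ x ∈ T, w x) ^ 2) := by
    calc _ ≤ ∑ _i : Fin n, K ^ 4 * (∑ x ∈ T, w x) ^ 2 := Finset.sum_le_sum fun i _ =>
          sq_sum_mul_le hw fun x hx => abs_mul_le_sq (hT x hx i) (hT x hx i)
      _ = _ := by simp
  have hfull : ∑ p, A p = ∑ x ∈ T, ∑ y ∈ T, w x * w y * (∑ i, x i * y i) ^ 2 := by
    rw [hA, sum_sq_of_products T w fun x (p : Fin n × Fin n) => x p.1 * x p.2]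
    refine Finset.sum_congr rfl fun x _ => Finset.sum_congr rfl fun y _ => ?_
    rw [pow_two, Finset.sum_mul_sum, Fintype.sum_prod_type]
    congr 1
    refine Finset.sum_congr rfl fun i _ => Finset.sum_congr rfl fun j _ => ?_
    ring
  have hlin : ∑ i, -(lam * q) * (∑ x ∈ T, w x * x i) ^ 2
      = -(lam * q) * ∑ x ∈ T, ∑ y ∈ T, w x * w y * ∑ i, x i * y i := by
    rw [← Finset.mul_sum, sum_sq_of_products T w fun x i => x i]
  have hone : (∑ x ∈ T, w x) ^ 2 = ∑ x ∈ T, ∑ y ∈ T, w x * w y := by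
    rw [pow_two, Finset.sum_mul_sum]
  have hsq : 0 ≤ lam / (2 * n) * (∑ x ∈ T, ∑ y ∈ T, w x * w y * (∑ i, x i * y i) ^ 2)
      - lam * q * (∑ x ∈ T, ∑ y ∈ T, w x * w y * ∑ i, x i * y i)
      + lam * n * q ^ 2 / 2 * ∑ x ∈ T, ∑ y ∈ T, w x * w y := by
    simp_rw [Finset.mul_sum (s := T), ← Finset.sum_sub_distrib, ← Finset.sum_add_distrib]
    refine Finset.sum_nonneg fun x hx => Finset.sum_nonneg fun y hy => ?_
    have : 0 ≤ lam / (2 * n) * (w x * w y) * ((∑ i, x i * y i) - n * q) ^ 2 := by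
      have := hw x hx
      have := hw y hy
      positivity
    refine this.trans_eq ?_
    field_simp
    ring
  rw [hpairs, hfull, hlin]
  rw [hone] at hdiag ⊢
  have h2 : lam / (2 * n) * ∑ i, A (i, i)
      ≤ lam / (2 * n) * (n * (K ^ 4 * ∑ x ∈ T, ∑ y ∈ T, w x * w y)) :=
    mul_le_mul_of_nonneg_left hdiag (by positivity)
  have h3 : lam / (2 * n) * (n * (K ^ 4 * ∑ x ∈ T, ∑ y ∈ T, w x * w y))
      = lam * K ^ 4 / 2 * ∑ x ∈ T, ∑ y ∈ T, w x * w y := by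
    field_simp
  have h4 : ∀ u v : ℝ, lam / n * ((u - v) / 2) = lam / (2 * n) * u - lam / (2 * n) * v := by
    intro u v
    field_simp
  rw [h4]
  linarith

lemma overlap_upper_bound (hn : 0 < n) {lam q : ℝ} (hlam : 0 < lam) (hq : 0 ≤ q)
    (hw : ∀ x ∈ T, 0 ≤ w x) (hT : ∀ x ∈ T, ∀ i, |x i| ≤ K) :
    ∑ p : Fin n × Fin n,
          (if p.1 < p.2 then lam / n else 0) * (∑ x ∈ T, w x * (x p.1 * x p.2)) ^ 2
        + ∑ i, -(lam * q) * (∑ x ∈ T, w x * x i) ^ 2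
      ≤ lam * n * K ^ 4 * (∑ x ∈ T, w x) ^ 2 := by
  have hn' : (0 : ℝ) < n := by exact_mod_cast hn
  have h1 : ∑ i, -(lam * q) * (∑ x ∈ T, w x * x i) ^ 2 ≤ 0 := by
    refine Finset.sum_nonpos fun i _ => ?_
    rw [neg_mul, neg_nonpos]
    positivity
  have h2 : ∑ p : Fin n × Fin n,
      (if p.1 < p.2 then lam / n else 0) * (∑ x ∈ T, w x * (x p.1 * x p.2)) ^ 2
      ≤ ∑ _p : Fin n × Fin n, lam / n * (K ^ 4 * (∑ x ∈ T, w x) ^ 2) := by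
    refine Finset.sum_le_sum fun p _ => ?_
    refine mul_le_mul ?_
      (sq_sum_mul_le hw fun x hx => abs_mul_le_sq (hT x hx p.1) (hT x hx p.2))
      (sq_nonneg _) (by positivity)
    split_ifs
    · exact le_rfl
    · positivity
  have h3 : ∑ _p : Fin n × Fin n, lam / n * (K ^ 4 * (∑ x ∈ T, w x) ^ 2)
      = lam * n * K ^ 4 * (∑ x ∈ T, w x) ^ 2 := by
    simp
    field_simp
  linarith

end Overlap

section Interpolation

/-- The signals of the interpolating model: all products `x i * x j`, and all spins `x i`. -/
def interpSignal (n : ℕ) (x : Fin n → ℝ) : (Fin n × Fin n) ⊕ Fin n → ℝ :=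
  Sum.elim (fun p => x p.1 * x p.2) x

/-- The amplitudes of the interpolating model: `θ = 0` is the decoupled scalar model and
`θ = π / 2` is the spiked Wigner model. -/
def interpAmplitude (n : ℕ) (lam q θ : ℝ) : (Fin n × Fin n) ⊕ Fin n → ℝ :=
  Sum.elim (fun p => if p.1 < p.2 then √(lam / n) * sin θ else 0) fun _ => √(lam * q) * cos θ

/-- The derivative of `interpAmplitude` in the angle. -/
def interpAmplitudeDeriv (n : ℕ) (lam q θ : ℝ) : (Fin n × Fin n) ⊕ Fin n → ℝ :=
  Sum.elim (fun p => if p.1 < p.2 then √(lam / n) * cos θ else 0) fun _ => √(lam * q) * -sin θ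

lemma hasDerivAt_interpAmplitude (n : ℕ) (lam q θ : ℝ) (a : (Fin n × Fin n) ⊕ Fin n) :
    HasDerivAt (fun θ => interpAmplitude n lam q θ a) (interpAmplitudeDeriv n lam q θ a) θ := by
  rcases a with p | i
  · simp only [interpAmplitude, interpAmplitudeDeriv, Sum.elim_inl]
    split_ifs
    · exact (hasDerivAt_sin θ).const_mul _
    · exact hasDerivAt_const _ _
  · simp only [interpAmplitude, interpAmplitudeDeriv, Sum.elim_inr]
    exact (hasDerivAt_cos θ).const_mul _

lemma abs_interpAmplitude_le (n : ℕ) (lam q θ : ℝ) (a : (Fin n × Fin n) ⊕ Fin n) :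
    |interpAmplitude n lam q θ a| ≤ √(lam / n) + √(lam * q) := by
  have h1 : √(lam / n) * |sin θ| ≤ √(lam / n) :=
    mul_le_of_le_one_right (sqrt_nonneg _) (abs_sin_le_one θ)
  have h2 : √(lam * q) * |cos θ| ≤ √(lam * q) :=
    mul_le_of_le_one_right (sqrt_nonneg _) (abs_cos_le_one θ)
  have h3 := sqrt_nonneg (lam / n)
  have h4 := sqrt_nonneg (lam * q)
  rcases a with p | i
  · simp only [interpAmplitude, Sum.elim_inl]
    split_ifs
    · rw [abs_mul, abs_of_nonneg h3]; linarith
    · rw [abs_zero]; positivity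
  · simp only [interpAmplitude, Sum.elim_inr]
    rw [abs_mul, abs_of_nonneg h4]; linarith

lemma abs_interpAmplitudeDeriv_le (n : ℕ) (lam q θ : ℝ) (a : (Fin n × Fin n) ⊕ Fin n) :
    |interpAmplitudeDeriv n lam q θ a| ≤ √(lam / n) + √(lam * q) := by
  have h1 : √(lam / n) * |cos θ| ≤ √(lam / n) :=
    mul_le_of_le_one_right (sqrt_nonneg _) (abs_cos_le_one θ)
  have h2 : √(lam * q) * |sin θ| ≤ √(lam * q) :=
    mul_le_of_le_one_right (sqrt_nonneg _) (abs_sin_le_one θ)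
  have h3 := sqrt_nonneg (lam / n)
  have h4 := sqrt_nonneg (lam * q)
  rcases a with p | i
  · simp only [interpAmplitudeDeriv, Sum.elim_inl]
    split_ifs
    · rw [abs_mul, abs_of_nonneg h3]; linarith
    · rw [abs_zero]; positivity
  · simp only [interpAmplitudeDeriv, Sum.elim_inr]
    rw [abs_mul, abs_of_nonneg h4, abs_neg]; linarith

lemma sum_interpAmplitude_mul {n : ℕ} {lam q : ℝ} (hlam : 0 < lam) (hq : 0 ≤ q) (θ : ℝ)
    (f : (Fin n × Fin n) ⊕ Fin n → ℝ) :
    ∑ a, interpAmplitudeDeriv n lam q θ a * interpAmplitude n lam q θ a * f a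
      = sin θ * cos θ * (∑ p : Fin n × Fin n, (if p.1 < p.2 then lam / n else 0) * f (.inl p)
        + ∑ i, -(lam * q) * f (.inr i)) := by
  have h1 : √(lam / n) * √(lam / n) = lam / n := mul_self_sqrt (by positivity)
  have h2 : √(lam * q) * √(lam * q) = lam * q := mul_self_sqrt (by positivity)
  rw [Fintype.sum_sum_type, mul_add, Finset.mul_sum, Finset.mul_sum]
  congr 1
  · refine Finset.sum_congr rfl fun p _ => ?_
    simp only [interpAmplitude, interpAmplitudeDeriv, Sum.elim_inl]
    split_ifs
    · linear_combination (sin θ * cos θ * f (.inl p)) * h1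
    · ring
  · refine Finset.sum_congr rfl fun p _ => ?_
    simp only [interpAmplitude, interpAmplitudeDeriv, Sum.elim_inr]
    linear_combination (-(sin θ * cos θ * f (.inr p))) * h2

variable {n : ℕ} {T : Finset (Fin n → ℝ)} {p : (Fin n → ℝ) → ℝ} {K lam q : ℝ}

lemma deriv_interp_bounds (hn : 0 < n) (hlam : 0 < lam) (hq : 0 ≤ q)
    (hp : ∀ x ∈ T, 0 ≤ p x) (hp1 : ∑ x ∈ T, p x = 1) (hT : ∀ x ∈ T, ∀ i, |x i| ≤ K)
    {θ : ℝ} (hθ : 0 ≤ sin θ * cos θ) :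
    (∫ y, (∑ a, interpAmplitudeDeriv n lam q θ a * interpAmplitude n lam q θ a
        * posteriorSum T p (interpSignal n) (fun x => interpSignal n x a)
          (interpAmplitude n lam q θ) y ^ 2)
      * (evidence T p (interpSignal n) (interpAmplitude n lam q θ) y)⁻¹ ∂(stdGaussPi _))
      ∈ Set.Icc (sin θ * cos θ * -(lam * n * q ^ 2 / 2 + lam * K ^ 4 / 2))
          (sin θ * cos θ * (lam * n * K ^ 4)) := by
  have hw : ∀ y, ∀ x ∈ T,
      0 ≤ p x * likelihood (interpAmplitude n lam q θ) (interpSignal n x) y :=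
    fun y x hx => mul_nonneg (hp x hx) (likelihood_pos _ _ _).le
  constructor
  · refine le_integral_of_mul_evidence_sq_le hp hp1 fun y => ?_
    rw [sum_interpAmplitude_mul hlam hq, mul_assoc]
    refine mul_le_mul_of_nonneg_left ?_ hθ
    have := overlap_lower_bound (q := q) hn hlam (hw y) hT
    simpa [evidence, posteriorSum, interpSignal] using this
  · have h : sin θ * cos θ * -(lam * n * K ^ 4) ≤ ∫ y,
        (∑ a, -(interpAmplitudeDeriv n lam q θ a * interpAmplitude n lam q θ a)
          * posteriorSum T p (interpSignal n) (fun x => interpSignal n x a)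
            (interpAmplitude n lam q θ) y ^ 2)
        * (evidence T p (interpSignal n) (interpAmplitude n lam q θ) y)⁻¹ ∂(stdGaussPi _) := by
      refine le_integral_of_mul_evidence_sq_le hp hp1 fun y => ?_
      simp_rw [neg_mul, Finset.sum_neg_distrib]
      rw [sum_interpAmplitude_mul hlam hq, mul_neg, neg_mul, neg_le_neg_iff,
        mul_assoc (sin θ * cos θ) (lam * n * K ^ 4)]
      refine mul_le_mul_of_nonneg_left ?_ hθ
      have := overlap_upper_bound hn hlam hq (hw y) hT
      simpa [evidence, posteriorSum, interpSignal] using this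
    simp_rw [neg_mul, Finset.sum_neg_distrib, neg_mul] at h
    rw [integral_neg] at h
    linarith

/-- Integrated form of the interpolation bounds. -/
lemma channelEntropy_interp_bounds (hn : 0 < n) (hlam : 0 < lam) (hq : 0 ≤ q)
    (hp : ∀ x ∈ T, 0 ≤ p x) (hp1 : ∑ x ∈ T, p x = 1) (hT : ∀ x ∈ T, ∀ i, |x i| ≤ K) :
    channelEntropy T p (interpSignal n) (interpAmplitude n lam q 0)
        - (lam * n * q ^ 2 + lam * K ^ 4) / 4
      ≤ channelEntropy T p (interpSignal n) (interpAmplitude n lam q (π / 2)) ∧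
    channelEntropy T p (interpSignal n) (interpAmplitude n lam q (π / 2))
      ≤ channelEntropy T p (interpSignal n) (interpAmplitude n lam q 0)
        + lam * n * K ^ 4 / 2 := by
  have hd := hasDerivAt_channelEntropy (s := interpSignal n) hp hp1
    (hasDerivAt_interpAmplitude n lam q) (abs_interpAmplitude_le n lam q)
    (abs_interpAmplitudeDeriv_le n lam q)
  have hsin : ∀ θ (m : ℝ), HasDerivAt (fun θ => m * sin θ ^ 2 / 2) (sin θ * cos θ * m) θ := by
    intro θ m
    refine ((((hasDerivAt_sin θ).pow 2).const_mul m).div_const 2).congr_deriv ?_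
    simp
    ring
  have hpos : ∀ θ ∈ interior (Set.Icc 0 (π / 2)), 0 ≤ sin θ * cos θ := by
    intro θ hθ
    rw [interior_Icc] at hθ
    exact mul_nonneg (sin_nonneg_of_nonneg_of_le_pi hθ.1.le (by linarith [hθ.2, pi_pos]))
      (cos_nonneg_of_neg_pi_div_two_le_of_le (by linarith [hθ.1, pi_pos]) hθ.2.le)
  have h0 : (0 : ℝ) ∈ Set.Icc 0 (π / 2) := ⟨le_rfl, by positivity⟩
  have h1 : π / 2 ∈ Set.Icc 0 (π / 2) := ⟨by positivity, le_rfl⟩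
  constructor
  · have hg := fun θ => (hd θ).sub (hsin θ (-(lam * n * q ^ 2 / 2 + lam * K ^ 4 / 2)))
    have hmono := monotoneOn_of_deriv_nonneg (convex_Icc 0 (π / 2))
      (fun θ _ => (hg θ).continuousAt.continuousWithinAt)
      (fun θ _ => (hg θ).differentiableAt.differentiableWithinAt) fun θ hθ => by
        rw [(hg θ).deriv]
        exact sub_nonneg.2 (deriv_interp_bounds hn hlam hq hp hp1 hT (hpos θ hθ)).1
    have := hmono h0 h1 h0.2
    simp only [Pi.sub_apply, sin_zero, sin_pi_div_two] at this
    linarith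
  · have hg := fun θ => (hsin θ (lam * n * K ^ 4)).sub (hd θ)
    have hmono := monotoneOn_of_deriv_nonneg (convex_Icc 0 (π / 2))
      (fun θ _ => (hg θ).continuousAt.continuousWithinAt)
      (fun θ _ => (hg θ).differentiableAt.differentiableWithinAt) fun θ hθ => by
        rw [(hg θ).deriv]
        exact sub_nonneg.2 (deriv_interp_bounds hn hlam hq hp hp1 hT (hpos θ hθ)).2
    have := hmono h0 h1 h0.2
    simp only [Pi.sub_apply, sin_zero, sin_pi_div_two] at this
    linarith

end Interpolation

section Endpoints

variable {P0 : Measure ℝ} [IsProbabilityMeasure P0] {S : Finset ℝ}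

lemma channelEntropy_interp_right (hsupp : P0 ((↑S : Set ℝ)ᶜ) = 0) {n : ℕ} (hn : 0 < n)
    {lam q : ℝ} (hlam : 0 < lam) :
    channelEntropy (Fintype.piFinset fun _ : Fin n => S)
        (fun x => (Measure.pi fun _ : Fin n => P0).real {x}) (interpSignal n)
        (interpAmplitude n lam q (π / 2))
      = n * freeEnergy P0 n lam := by
  have hn' : (n : ℝ) ≠ 0 := by exact_mod_cast hn.ne'
  have hT := pi_piFinset_compl_null (ι := Fin n) hsupp
  rw [← integral_integral_log_eq_channelEntropy hT, freeEnergy, ← mul_assoc, mul_one_div_cancel hn',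
    one_mul]
  congr 1
  ext X
  have hH : ∀ x (z : (Fin n × Fin n) ⊕ Fin n → ℝ),
      ∑ a, (interpAmplitude n lam q (π / 2) a * interpSignal n x a * z a
        + interpAmplitude n lam q (π / 2) a ^ 2 * interpSignal n X a * interpSignal n x a
        - (interpAmplitude n lam q (π / 2) a * interpSignal n x a) ^ 2 / 2)
      = hamiltonian n lam X (fun p => z (.inl p)) x := by
    intro x z
    have h1 : √(lam / n) ^ 2 = lam / n := sq_sqrt (by positivity)
    rw [Fintype.sum_sum_type, hamiltonian, pairs, Finset.sum_filter]
    simp only [interpAmplitude, interpSignal, Sum.elim_inl, Sum.elim_inr, cos_pi_div_two,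
      sin_pi_div_two, mul_one, mul_zero, zero_mul, ne_eq, OfNat.ofNat_ne_zero, not_false_eq_true,
      zero_pow, zero_div, add_zero, sub_zero, Finset.sum_const_zero]
    refine Finset.sum_congr rfl fun p _ => ?_
    split_ifs
    · rw [mul_pow, h1]
      field_simp
    · ring
  simp_rw [hH]
  have hmp : MeasurePreserving (fun (z : (Fin n × Fin n) ⊕ Fin n → ℝ) p => z (.inl p))
      (stdGaussPi ((Fin n × Fin n) ⊕ Fin n)) (stdGaussPi (Fin n × Fin n)) :=
    measurePreserving_fst.comp
      (measurePreserving_sumPiEquivProdPi fun _ : (Fin n × Fin n) ⊕ Fin n => stdGauss)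
  have hmeas : Measurable fun Z => log (∫ x, exp (hamiltonian n lam X Z x)
      ∂(Measure.pi fun _ : Fin n => P0)) := by
    simp_rw [integral_of_finset_support hT, hamiltonian]
    fun_prop
  have h := integral_map (f := fun Z => log (∫ x, exp (hamiltonian n lam X Z x)
      ∂(Measure.pi fun _ : Fin n => P0))) hmp.measurable.aemeasurable
    (by rw [hmp.map_eq]; exact hmeas.aestronglyMeasurable)
  rw [hmp.map_eq] at h
  exact h.symm

/-- Integrability of the scalar log-partition function. -/
lemma integrable_log_scalar (hsupp : P0 ((↑S : Set ℝ)ᶜ) = 0) (γ x0 : ℝ) :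
    Integrable (fun z => log (∫ x, exp (√γ * z * x + γ * x * x0 - γ / 2 * x ^ 2) ∂P0))
      stdGauss := by
  set e : ℝ → ℝ → ℝ := fun z x => √γ * z * x + γ * x * x0 - γ / 2 * x ^ 2 with he
  obtain ⟨k, D, hkD⟩ : ∃ k D : ℝ, ∀ z, ∀ x ∈ S, |e z x| ≤ D + k * |z| := by
    refine ⟨∑ x ∈ S, |√γ * x|, ∑ x ∈ S, |γ * x * x0 - γ / 2 * x ^ 2|, fun z x hx => ?_⟩
    have h1 := Finset.single_le_sum (f := fun x => |√γ * x|) (fun _ _ => abs_nonneg _) hx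
    have h2 := Finset.single_le_sum (f := fun x => |γ * x * x0 - γ / 2 * x ^ 2|)
      (fun _ _ => abs_nonneg _) hx
    calc |e z x| = |(γ * x * x0 - γ / 2 * x ^ 2) + √γ * x * z| := by simp only [he]; congr 1; ring
      _ ≤ |γ * x * x0 - γ / 2 * x ^ 2| + |√γ * x| * |z| := by
          rw [← abs_mul]; exact abs_add_le _ _
      _ ≤ _ := add_le_add h2 (mul_le_mul_of_nonneg_right h1 (abs_nonneg z))
  have hae : ∀ᵐ x ∂P0, x ∈ S := mem_ae_iff.2 hsupp
  have hlow : ∀ z, exp (-(D + k * |z|)) ≤ ∫ x, exp (e z x) ∂P0 := by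
    intro z
    calc exp (-(D + k * |z|)) = ∫ _, exp (-(D + k * |z|)) ∂P0 := by simp
      _ ≤ _ := by
        refine integral_mono_ae (integrable_of_finset_support hsupp _)
          (integrable_of_finset_support hsupp _) ?_
        filter_upwards [hae] with x hx
        exact exp_le_exp.2 (abs_le.1 (hkD z x hx)).1
  have hupp : ∀ z, ∫ x, exp (e z x) ∂P0 ≤ exp (D + k * |z|) := by
    intro z
    calc _ ≤ ∫ _, exp (D + k * |z|) ∂P0 := by
          refine integral_mono_ae (integrable_of_finset_support hsupp _)
            (integrable_of_finset_support hsupp _) ?_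
          filter_upwards [hae] with x hx
          exact exp_le_exp.2 (abs_le.1 (hkD z x hx)).2
      _ = _ := by simp
  have hmeas : Measurable fun z => log (∫ x, exp (e z x) ∂P0) := by
    simp_rw [integral_of_finset_support hsupp, he]
    fun_prop
  refine ((integrable_exp_mul_abs_stdGauss k).const_mul (exp D)).mono' hmeas.aestronglyMeasurable
    (Eventually.of_forall fun z => ?_)
  have hpos := (exp_pos _).trans_le (hlow z)
  have habs : |log (∫ x, exp (e z x) ∂P0)| ≤ D + k * |z| :=
    abs_le.2 ⟨(le_log_iff_exp_le hpos).2 (hlow z), (log_le_iff_le_exp hpos).2 (hupp z)⟩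
  rw [norm_eq_abs, ← exp_add]
  linarith [add_one_le_exp (D + k * |z|)]

lemma channelEntropy_interp_left (hsupp : P0 ((↑S : Set ℝ)ᶜ) = 0) (n : ℕ)
    {lam q : ℝ} (hlam : 0 < lam) (hq : 0 ≤ q) :
    channelEntropy (Fintype.piFinset fun _ : Fin n => S)
        (fun x => (Measure.pi fun _ : Fin n => P0).real {x}) (interpSignal n)
        (interpAmplitude n lam q 0)
      = n * scalarFE P0 (lam * q) := by
  have hT := pi_piFinset_compl_null (ι := Fin n) hsupp
  rw [← integral_integral_log_eq_channelEntropy hT]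
  set ℓ : ℝ → ℝ → ℝ := fun x0 z =>
    log (∫ x, exp (√(lam * q) * z * x + lam * q * x * x0 - lam * q / 2 * x ^ 2) ∂P0) with hℓ
  have hH : ∀ X (z : (Fin n × Fin n) ⊕ Fin n → ℝ),
      log (∫ x, exp (∑ a, (interpAmplitude n lam q 0 a * interpSignal n x a * z a
        + interpAmplitude n lam q 0 a ^ 2 * interpSignal n X a * interpSignal n x a
        - (interpAmplitude n lam q 0 a * interpSignal n x a) ^ 2 / 2))
        ∂(Measure.pi fun _ : Fin n => P0))
      = ∑ i, ℓ (X i) (z (.inr i)) := by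
    intro X z
    have h1 : √(lam * q) ^ 2 = lam * q := sq_sqrt (by positivity)
    have hexp : ∀ x : Fin n → ℝ,
        exp (∑ a, (interpAmplitude n lam q 0 a * interpSignal n x a * z a
          + interpAmplitude n lam q 0 a ^ 2 * interpSignal n X a * interpSignal n x a
          - (interpAmplitude n lam q 0 a * interpSignal n x a) ^ 2 / 2))
        = ∏ i, exp (√(lam * q) * z (.inr i) * x i + lam * q * x i * X i
            - lam * q / 2 * x i ^ 2) := by
      intro x
      rw [← exp_sum, Fintype.sum_sum_type]
      simp only [interpAmplitude, interpSignal, Sum.elim_inl, Sum.elim_inr, cos_zero,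
        sin_zero, mul_one, mul_zero, zero_mul, ne_eq, OfNat.ofNat_ne_zero, not_false_eq_true,
        zero_pow, zero_div, add_zero, sub_zero, Finset.sum_const_zero, ite_self, zero_add]
      congr 1
      refine Finset.sum_congr rfl fun i _ => ?_
      rw [mul_pow, h1]
      ring
    simp_rw [hexp]
    rw [integral_fintype_prod_eq_prod (fun i (t : ℝ) => exp (√(lam * q) * z (.inr i) * t
      + lam * q * t * X i - lam * q / 2 * t ^ 2)), log_prod]
    intro i _
    exact (integral_exp_pos (integrable_of_finset_support hsupp _)).ne'
  simp_rw [hH]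
  have hℓi : ∀ x0, Integrable (ℓ x0) stdGauss := integrable_log_scalar hsupp (lam * q)
  have hz : ∀ X : Fin n → ℝ, ∫ z, ∑ i, ℓ (X i) (z (.inr i))
      ∂(stdGaussPi ((Fin n × Fin n) ⊕ Fin n)) = ∑ i, ∫ t, ℓ (X i) t ∂stdGauss := by
    intro X
    rw [integral_finsetSum]
    · refine Finset.sum_congr rfl fun i _ => ?_
      exact integral_comp_eval (μ := fun _ : (Fin n × Fin n) ⊕ Fin n => stdGauss)
        (hℓi (X i)).aestronglyMeasurable
    · intro i _
      exact integrable_comp_eval (μ := fun _ : (Fin n × Fin n) ⊕ Fin n => stdGauss) (hℓi (X i))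
  simp_rw [hz]
  rw [integral_finsetSum _ fun i _ => integrable_of_finset_support hT _]
  have hX : ∀ i : Fin n, ∫ X, (∫ t, ℓ (X i) t ∂stdGauss) ∂(Measure.pi fun _ : Fin n => P0)
      = scalarFE P0 (lam * q) := fun i =>
    integral_comp_eval (μ := fun _ : Fin n => P0) (f := fun x0 => ∫ t, ℓ x0 t ∂stdGauss)
      (integrable_of_finset_support hsupp _).aestronglyMeasurable
  simp [hX]

/-- The interpolation bounds for the free energy at fixed size. -/
lemma freeEnergy_bounds {K : ℝ} (hSK : ∀ x ∈ S, x ∈ Set.Icc (-K) K)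
    (hsupp : P0 ((↑S : Set ℝ)ᶜ) = 0) {n : ℕ} (hn : 0 < n) {lam q : ℝ} (hlam : 0 < lam)
    (hq : 0 ≤ q) :
    RSpot P0 lam q - lam * K ^ 4 / 4 / n ≤ freeEnergy P0 n lam ∧
      freeEnergy P0 n lam ≤ scalarFE P0 (lam * q) + lam * K ^ 4 / 2 := by
  have hn' : (0 : ℝ) < n := by exact_mod_cast hn
  have hT := pi_piFinset_compl_null (ι := Fin n) hsupp
  have h := channelEntropy_interp_bounds (K := K) (T := Fintype.piFinset fun _ : Fin n => S)
    hn hlam hq (fun _ _ => measureReal_nonneg) (sum_real_of_finset_support hT)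
    fun x hx i => abs_le.2 (hSK _ (Fintype.mem_piFinset.1 hx i))
  rw [channelEntropy_interp_left hsupp n hlam hq, channelEntropy_interp_right hsupp hn hlam] at h
  constructor
  · refine le_of_mul_le_mul_left (le_trans (le_of_eq ?_) h.1) hn'
    rw [RSpot]
    field_simp
    ring
  · refine le_of_mul_le_mul_left (h.2.trans (le_of_eq ?_)) hn'
    ring

end Endpoints

/-- **Guerra's interpolation bound**: for a prior `P0` with finite support `S ⊆ [−K, K]`,
`liminf_n F_n(λ) ≥ sup_{q ≥ 0} 𝓕(λ, q)` for every `λ > 0`. -/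
theorem guerra_lower_bound (P0 : Measure ℝ) [IsProbabilityMeasure P0]
    (S : Finset ℝ) (K : ℝ) (hK : 0 < K) (hSK : ∀ x ∈ S, x ∈ Set.Icc (-K) K)
    (hsupp : P0 ((↑S : Set ℝ)ᶜ) = 0) (lam : ℝ) (hlam : 0 < lam) :
    RSsup P0 lam ≤ liminf (fun n => freeEnergy P0 n lam) atTop := by
  refine csSup_le (Set.nonempty_Ici.image _) ?_
  rintro _ ⟨q, hq, rfl⟩
  have hlim : Tendsto (fun n : ℕ => RSpot P0 lam q - lam * K ^ 4 / 4 / n) atTop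
      (nhds (RSpot P0 lam q)) := by
    simpa using (tendsto_const_div_atTop_nhds_zero_nat (lam * K ^ 4 / 4)).const_sub (RSpot P0 lam q)
  rw [← hlim.liminf_eq]
  refine liminf_le_liminf ?_ hlim.isBoundedUnder_ge ?_
  · filter_upwards [eventually_gt_atTop 0] with n hn
    exact (freeEnergy_bounds hSK hsupp hn hlam hq).1
  · refine Filter.IsBoundedUnder.isCoboundedUnder_ge
      ⟨scalarFE P0 (lam * q) + lam * K ^ 4 / 2, ?_⟩
    rw [eventually_map]
    filter_upwards [eventually_gt_atTop 0] with n hn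
    exact (freeEnergy_bounds hSK hsupp hn hlam hq).2

end
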